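/- arXiv:1407.7834 — 3 statements merged into one kernel-verified Lean document; each statement's English description precedes it below -/
import Mathlib

section
/- Let r ≥ 2, let F be the free group of rank r, and fix v ∈ F. The set of elements of F that contain v as a subword is exponentially generic in F. -/
namespace VG

variable {r : ℕ}

/-- Word length: the length of the unique freely reduced word representing `w`. -/
def len (w : FreeGroup (Fin r)) : ℕ := (FreeGroup.toWord w).length

/-- The number of elements of `A` of word length at most `n`. -/
noncomputable def ballCount (A : Set (FreeGroup (Fin r))) (n : ℕ) : ℕ :=
  {w | w ∈ A ∧ len w ≤ n}.ncard

/-- The number of elements of `A` of word length exactly `n`. -/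
noncomputable def sphereCount (A : Set (FreeGroup (Fin r))) (n : ℕ) : ℕ :=
  {w | w ∈ A ∧ len w = n}.ncard

/-- `A` is exponentially generic in `B`: there are `a > 0` and `b` such that, for all
sufficiently large `n`, the proportion of elements of `B` of length at most `n` lying
in `A` is at least `1 - exp (b - a n)`. -/
def ExpGeneric (A B : Set (FreeGroup (Fin r))) : Prop :=
  ∃ a : ℝ, 0 < a ∧ ∃ b : ℝ, ∃ N : ℕ, ∀ n : ℕ, N ≤ n →
    (1 : ℝ) - Real.exp (b - a * n) ≤ (ballCount A n : ℝ) / (ballCount B n)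

/-- `A` is exponentially rare in `B` if its complement in `B` is exponentially generic. -/
def ExpRare (A B : Set (FreeGroup (Fin r))) : Prop := ExpGeneric (B \ A) B

/-- `v` is a subword of `w`: the reduced word of `v` is a contiguous sublist of that of `w`. -/
def Subword (v w : FreeGroup (Fin r)) : Prop :=
  FreeGroup.toWord v <:+: FreeGroup.toWord w

/-- `w` is cyclically reduced: the first letter of its reduced word is not the inverse of
the last letter. -/
def CyclicallyReduced (w : FreeGroup (Fin r)) : Prop :=
  ∀ a ∈ (FreeGroup.toWord w).head?, ∀ b ∈ (FreeGroup.toWord w).getLast?,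
    a ≠ (b.1, !b.2)

/-- `c` is the cyclic reduction of `w`: it is cyclically reduced and conjugate to `w`. -/
def IsCyclicReduction (c w : FreeGroup (Fin r)) : Prop :=
  CyclicallyReduced c ∧ ∃ g : FreeGroup (Fin r), w = g * c * g⁻¹

/-- Middle third of a list: delete the first and last `⌈l/3⌉` entries. -/
def middleThird {α : Type*} (l : List α) : List α :=
  (l.drop ((l.length + 2) / 3)).take (l.length - 2 * ((l.length + 2) / 3))

/-- `v` is cyclically contained in `w` if the reduced word of `v` is a subword of some
positive power of the cyclic reduction of `w`. -/
def CyclicallyContains (w v : FreeGroup (Fin r)) : Prop :=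
  ∃ c : FreeGroup (Fin r), IsCyclicReduction c w ∧ ∃ k : ℕ, 1 ≤ k ∧ Subword v (c ^ k)

/-- `w` is full: every freely reduced word of length 3, or its inverse, is cyclically
contained in `w`. -/
def Full (w : FreeGroup (Fin r)) : Prop :=
  ∀ t : FreeGroup (Fin r), len t = 3 → CyclicallyContains w t ∨ CyclicallyContains w t⁻¹

/-- The group element corresponding to a single letter. -/
def letterElem (a : Fin r × Bool) : FreeGroup (Fin r) := FreeGroup.mk [a]

/-- The inverse of a letter. -/
def linv (a : Fin r × Bool) : Fin r × Bool := (a.1, !a.2)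

/-- `w` is a proper power: `w = u^k` for some `k ≥ 2`. -/
def ProperPower (w : FreeGroup (Fin r)) : Prop :=
  ∃ u : FreeGroup (Fin r), ∃ k : ℕ, 2 ≤ k ∧ w = u ^ k

/-- Minimal word length in the conjugacy class of `w`. -/
noncomputable def conjMinLen (w : FreeGroup (Fin r)) : ℕ :=
  sInf (len '' {u | IsConj u w})

/-- `w` is Whitehead minimal: for every automorphism `α` of the free group, the length of
`w` is at most the minimal length of an element conjugate to `α w`. -/
def WhiteheadMinimal (w : FreeGroup (Fin r)) : Prop :=
  ∀ α : FreeGroup (Fin r) ≃* FreeGroup (Fin r), len w ≤ conjMinLen (α w)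


section Helpers

open Finset Classical

/-- Letters which can be prepended to `w` keeping it reduced. -/
noncomputable def goodLetters (w : List (Fin r × Bool)) : Finset (Fin r × Bool) :=
  Finset.univ.filter (fun c => FreeGroup.IsReduced (c :: w))

/-- Reduced extensions of `w` by `m` letters on the left. -/
noncomputable def extWords (w : List (Fin r × Bool)) : ℕ → Finset (List (Fin r × Bool))
  | 0 => {w}
  | m + 1 => (extWords w m).biUnion (fun l => (goodLetters l).image (fun c => c :: l))

lemma mem_goodLetters (w : List (Fin r × Bool)) (c : Fin r × Bool) :
    c ∈ goodLetters w ↔ FreeGroup.IsReduced (c :: w) := by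
  simp [goodLetters]

lemma bool_aux (c d : Fin r × Bool) : (c.1 = d.1 → c.2 = d.2) ↔ c ≠ linv d := by
  obtain ⟨c, x⟩ := c
  obtain ⟨d, y⟩ := d
  cases x <;> cases y <;> simp [linv]

lemma card_goodLetters_cons (d : Fin r × Bool) (w : List (Fin r × Bool))
    (h : FreeGroup.IsReduced (d :: w)) : (goodLetters (d :: w)).card = 2 * r - 1 := by
  have : goodLetters (d :: w) = Finset.univ.erase (linv d) := by
    ext c
    simp only [mem_goodLetters, FreeGroup.isReduced_cons_cons, bool_aux, h]
    simp
  rw [this, Finset.card_erase_of_mem (Finset.mem_univ _)]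
  simp [mul_comm]

lemma card_goodLetters_ge (w : List (Fin r × Bool))
    (h : FreeGroup.IsReduced w) : 2 * r - 1 ≤ (goodLetters w).card := by
  cases w with
  | nil =>
    have : goodLetters ([] : List (Fin r × Bool)) = Finset.univ := by
      ext c
      simp [mem_goodLetters]
    rw [this]
    simp [mul_comm]
  | cons d w => exact (card_goodLetters_cons d w h).ge

lemma mem_extWords (w : List (Fin r × Bool)) (hw : FreeGroup.IsReduced w) (m : ℕ) :
    ∀ u, u ∈ extWords w m ↔
      FreeGroup.IsReduced u ∧ ∃ p : List (Fin r × Bool), p.length = m ∧ u = p ++ w := by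
  induction m with
  | zero =>
    intro u
    simp only [extWords, Finset.mem_singleton, List.length_eq_zero_iff]
    constructor
    · rintro rfl
      exact ⟨hw, [], rfl, rfl⟩
    · rintro ⟨_, p, rfl, rfl⟩
      rfl
  | succ m ih =>
    intro u
    simp only [extWords, Finset.mem_biUnion, Finset.mem_image, ih, mem_goodLetters]
    constructor
    · rintro ⟨l, ⟨_, p, hp, rfl⟩, c, hc, rfl⟩
      exact ⟨hc, c :: p, by simp [hp], rfl⟩
    · rintro ⟨hu, p, hp, rfl⟩
      cases p with
      | nil => simp at hp
      | cons c p =>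
        refine ⟨p ++ w, ⟨?_, p, by simpa using hp, rfl⟩, c, hu, rfl⟩
        exact hu.infix ⟨[c], [], by simp⟩

lemma card_extWords_succ (w : List (Fin r × Bool)) (m : ℕ) :
    (extWords w (m + 1)).card = ∑ l ∈ extWords w m, (goodLetters l).card := by
  rw [extWords, Finset.card_biUnion]
  · refine Finset.sum_congr rfl fun l _ => ?_
    exact Finset.card_image_of_injective _ (fun a b h => by simpa using h)
  · intro a _ b _ hab
    rw [Function.onFun, Finset.disjoint_left]
    intro u hu hu2
    simp only [Finset.mem_image] at hu hu2
    obtain ⟨c, _, rfl⟩ := hu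
    obtain ⟨c', _, h⟩ := hu2
    simp only [List.cons.injEq] at h
    exact hab h.2.symm

lemma card_extWords_ge (w : List (Fin r × Bool)) (hw : FreeGroup.IsReduced w) (m : ℕ) :
    (2 * r - 1) ^ m ≤ (extWords w m).card := by
  induction m with
  | zero => simp [extWords]
  | succ m ih =>
    rw [card_extWords_succ, pow_succ]
    calc _ ≤ (extWords w m).card * (2 * r - 1) := Nat.mul_le_mul_right _ ih
      _ ≤ _ := by
        rw [← smul_eq_mul]
        refine Finset.card_nsmul_le_sum _ _ _ fun l hl => ?_
        exact card_goodLetters_ge l ((mem_extWords w hw m l).1 hl).1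

lemma card_extWords_eq (w : List (Fin r × Bool)) (hw : FreeGroup.IsReduced w) (hne : w ≠ [])
    (m : ℕ) : (extWords w m).card = (2 * r - 1) ^ m := by
  induction m with
  | zero => simp [extWords]
  | succ m ih =>
    rw [card_extWords_succ, pow_succ, ← ih, ← smul_eq_mul]
    refine Finset.sum_const_nat fun l hl => ?_
    obtain ⟨h, p, hp, e⟩ := (mem_extWords w hw m l).1 hl
    cases l with
    | nil => simp [eq_comm] at e; exact absurd e.2 hne
    | cons d l => exact card_goodLetters_cons d l h

/-- Reduced words of length `n` avoiding `v`. -/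
noncomputable def badWords (v : List (Fin r × Bool)) (n : ℕ) : Finset (List (Fin r × Bool)) :=
  (extWords [] n).filter (fun w => ¬ v <:+: w)

lemma mem_badWords (v : List (Fin r × Bool)) (n : ℕ) (w : List (Fin r × Bool)) :
    w ∈ badWords v n ↔ FreeGroup.IsReduced w ∧ w.length = n ∧ ¬ v <:+: w := by
  simp [badWords, mem_extWords [] FreeGroup.IsReduced.nil, and_assoc]

lemma exists_connect (hr : 2 ≤ r) (v w : List (Fin r × Bool)) (hv : FreeGroup.IsReduced v)
    (hw : FreeGroup.IsReduced w) :
    ∃ c, FreeGroup.IsReduced (v ++ c :: w) := by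
  have h1 := card_goodLetters_ge w hw
  -- letters allowed after `v`
  have key : ∃ e : Fin r × Bool, ∀ c, c ≠ e → ∀ x ∈ v.getLast?, x.1 = c.1 → x.2 = c.2 := by
    cases h : v.getLast? with
    | none => exact ⟨(⟨0, by omega⟩, true), by simp⟩
    | some x =>
      refine ⟨linv x, fun c hc y hy => ?_⟩
      simp only [Option.mem_def, Option.some.injEq] at hy
      subst hy
      have := (bool_aux c x).2 hc
      exact fun hh => (this hh.symm).symm
  obtain ⟨e, he⟩ := key
  obtain ⟨c, hc, hce⟩ := Finset.exists_mem_ne (s := goodLetters w) (by omega) e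
  refine ⟨c, ?_⟩
  rw [FreeGroup.IsReduced, List.isChain_append]
  refine ⟨hv, (mem_goodLetters w c).1 hc, fun x hx y hy => ?_⟩
  simp only [List.head?_cons, Option.mem_def, Option.some.injEq] at hy
  subst hy
  exact he c hce x hx

lemma badWords_rec (hr : 2 ≤ r) (v : List (Fin r × Bool)) (hv : FreeGroup.IsReduced v) (n : ℕ)
    (hn : 1 ≤ n) :
    (badWords v (n + (v.length + 1))).card ≤
      (badWords v n).card * ((2 * r - 1) ^ (v.length + 1) - 1) := by
  have hc : ∀ w : List (Fin r × Bool), ∃ c, FreeGroup.IsReduced w →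
      FreeGroup.IsReduced (v ++ c :: w) := by
    intro w
    by_cases hw : FreeGroup.IsReduced w
    · obtain ⟨c, h⟩ := exists_connect hr v w hv hw
      exact ⟨c, fun _ => h⟩
    · exact ⟨(⟨0, by omega⟩, true), fun h => absurd h hw⟩
  choose f hf using hc
  have hsub : badWords v (n + (v.length + 1)) ⊆ (badWords v n).biUnion
      (fun w => (extWords w (v.length + 1)).erase (v ++ f w :: w)) := by
    intro u hu
    obtain ⟨h1, h2, h3⟩ := (mem_badWords _ _ _).1 hu
    have hd : u = u.take (v.length + 1) ++ u.drop (v.length + 1) := by simp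
    have hred : FreeGroup.IsReduced (u.drop (v.length + 1)) :=
      h1.infix (List.drop_suffix _ _).isInfix
    refine Finset.mem_biUnion.2 ⟨u.drop (v.length + 1), ?_, ?_⟩
    · refine (mem_badWords _ _ _).2 ⟨hred, by simp [h2], fun h => h3 ?_⟩
      exact h.trans (List.drop_suffix _ _).isInfix
    · refine Finset.mem_erase.2 ⟨fun h => h3 ?_, ?_⟩
      · rw [h]
        exact (List.prefix_append _ _).isInfix
      · refine (mem_extWords _ hred _ _).2 ⟨h1, _, ?_, hd⟩
        simp [h2]
  refine (Finset.card_le_card hsub).trans (Finset.card_biUnion_le_card_mul _ _ _ fun w hw => ?_)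
  obtain ⟨h1, h2, h3⟩ := (mem_badWords _ _ _).1 hw
  have hne : w ≠ [] := by
    rintro rfl
    simp at h2
    omega
  rw [Finset.card_erase_of_mem, card_extWords_eq w h1 hne]
  exact (mem_extWords w h1 _ _).2 ⟨hf w h1, v ++ [f w], by simp, by simp⟩

lemma ball_finite (n : ℕ) : {w : FreeGroup (Fin r) | len w ≤ n}.Finite := by
  refine Set.Finite.of_finite_image (f := FreeGroup.toWord) ?_
    (FreeGroup.toWord_injective.injOn)
  refine (List.finite_length_le (Fin r × Bool) n).subset ?_
  rintro _ ⟨w, hw, rfl⟩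
  exact hw

lemma ballCount_univ_ge (n : ℕ) :
    (2 * r - 1) ^ n ≤ ballCount (Set.univ : Set (FreeGroup (Fin r))) n := by
  refine (card_extWords_ge [] FreeGroup.IsReduced.nil n).trans ?_
  rw [← Set.ncard_coe_finset, ballCount,
    ← Set.ncard_image_of_injective _ FreeGroup.toWord_injective]
  refine Set.ncard_le_ncard ?_ (((ball_finite n).subset (fun w hw => hw.2)).image _)
  intro u hu
  obtain ⟨h1, p, hp, rfl⟩ := (mem_extWords [] FreeGroup.IsReduced.nil n u).1 hu
  refine ⟨FreeGroup.mk (p ++ []), ⟨trivial, ?_⟩, ?_⟩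
  · rw [len, FreeGroup.toWord_mk, h1.reduce_eq]
    simp [hp]
  · rw [FreeGroup.toWord_mk, h1.reduce_eq]

lemma ballCount_split (v : FreeGroup (Fin r)) (n : ℕ) :
    ballCount (Set.univ : Set (FreeGroup (Fin r))) n ≤
      ballCount {w : FreeGroup (Fin r) | Subword v w} n +
        ∑ j ∈ Finset.range (n + 1), (badWords v.toWord j).card := by
  have hbad : {w : FreeGroup (Fin r) | ¬ Subword v w ∧ len w ≤ n}.ncard ≤
      ∑ j ∈ Finset.range (n + 1), (badWords v.toWord j).card := by
    refine le_trans ?_ Finset.card_biUnion_le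
    rw [← Set.ncard_coe_finset, ← Set.ncard_image_of_injective _ FreeGroup.toWord_injective]
    refine Set.ncard_le_ncard ?_ (Finset.finite_toSet _)
    rintro _ ⟨w, ⟨hw, hl⟩, rfl⟩
    simp only [Finset.coe_biUnion, Set.mem_iUnion]
    refine ⟨len w, by simpa using Nat.lt_succ_of_le hl, ?_⟩
    exact (mem_badWords _ _ _).2 ⟨FreeGroup.isReduced_toWord, rfl, hw⟩
  refine le_trans ?_ (Nat.add_le_add_left hbad _)
  refine le_trans (Set.ncard_le_ncard ?_ ?_) (Set.ncard_union_le _ _)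
  · rintro w ⟨-, hw⟩
    by_cases h : Subword v w
    · exact Or.inl ⟨h, hw⟩
    · exact Or.inr ⟨h, hw⟩
  · exact ((ball_finite n).subset (fun w hw => hw.2)).union
      ((ball_finite n).subset (fun w hw => hw.2))

/-- Growth estimate from the recursive inequality. -/
lemma growth (b : ℕ → ℕ) (q m : ℕ) (hq : 3 ≤ q) (hm : 1 ≤ m)
    (h : ∀ n, 1 ≤ n → b (n + m) ≤ b n * (q ^ m - 1)) :
    ∃ C lam : ℝ, 0 < C ∧ 1 < lam ∧ lam < q ∧
      ∀ n, (∑ j ∈ Finset.range (n + 1), (b j : ℝ)) ≤ C * lam ^ n := by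
  have hqm : q ≤ q ^ m := Nat.le_self_pow (by omega) q
  have hm0 : m ≠ 0 := by omega
  set t : ℝ := ((q ^ m - 1 : ℕ) : ℝ) with ht
  have ht' : t = (q : ℝ) ^ m - 1 := by
    rw [ht, Nat.cast_sub (by omega)]
    simp
  have ht1 : 1 < t := by
    rw [ht]
    exact_mod_cast (by omega : 1 < q ^ m - 1)
  set lam : ℝ := t ^ ((m : ℝ)⁻¹) with hlam
  have hpow : lam ^ m = t := Real.rpow_inv_natCast_pow (by linarith) hm0
  have hl0 : 0 ≤ lam := Real.rpow_nonneg (by linarith) _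
  have hl1 : 1 < lam := by
    by_contra! hh
    have := pow_le_one₀ (n := m) hl0 hh
    linarith
  have hlq : lam < q := by
    by_contra! hh
    have := pow_le_pow_left₀ (Nat.cast_nonneg q) hh m
    linarith
  set D : ℝ := 1 + ∑ j ∈ Finset.range (m + 1), (b j : ℝ) with hD
  have hD0 : 0 < D := by positivity
  have hb : ∀ n, (b n : ℝ) ≤ D * lam ^ n := by
    intro n
    induction n using Nat.strong_induction_on with
    | _ n ih =>
      by_cases hn : n ≤ m
      · have h1 : (b n : ℝ) ≤ ∑ j ∈ Finset.range (m + 1), (b j : ℝ) :=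
          Finset.single_le_sum (f := fun j => (b j : ℝ)) (fun _ _ => Nat.cast_nonneg _)
            (Finset.mem_range.2 (by omega))
        have h2 : 1 ≤ lam ^ n := one_le_pow₀ hl1.le
        nlinarith
      · obtain ⟨k, rfl⟩ : ∃ k, n = k + m := ⟨n - m, by omega⟩
        have h1 := h k (by omega)
        have h2 := ih k (by omega)
        have h3 : (b (k + m) : ℝ) ≤ b k * t := by
          rw [ht]
          exact_mod_cast h1
        rw [pow_add, hpow]
        nlinarith
  refine ⟨D * (lam / (lam - 1)), lam, ?_, hl1, hlq, fun n => ?_⟩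
  · have : 0 < lam - 1 := by linarith
    positivity
  · have hpos : 0 < lam - 1 := by linarith
    calc _ ≤ ∑ j ∈ Finset.range (n + 1), D * lam ^ j := Finset.sum_le_sum fun j _ => hb j
      _ = D * ((lam ^ (n + 1) - 1) / (lam - 1)) := by
        rw [← Finset.mul_sum, geom_sum_eq hl1.ne']
      _ ≤ D * (lam ^ (n + 1) / (lam - 1)) := by
        gcongr
        linarith
      _ = _ := by
        rw [pow_succ]
        field_simp

end Helpers

/-- the set of elements containing `v` as a subword is exponentially
generic in `F`. -/
theorem subword_expGeneric {r : ℕ} (hr : 2 ≤ r) (v : FreeGroup (Fin r)) :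
    ExpGeneric {w : FreeGroup (Fin r) | Subword v w}
      (Set.univ : Set (FreeGroup (Fin r))) := by
  obtain ⟨C, lam, hC, hl1, hlq, hsum⟩ := growth (fun n => (badWords v.toWord n).card)
    (2 * r - 1) (v.toWord.length + 1) (by omega) (by omega)
    (fun n hn => badWords_rec hr v.toWord FreeGroup.isReduced_toWord n hn)
  set q : ℝ := ((2 * r - 1 : ℕ) : ℝ) with hq
  have hl0 : 0 < lam := by linarith
  have hq0 : 0 < q := by linarith
  refine ⟨Real.log q - Real.log lam, sub_pos.2 (Real.log_lt_log hl0 hlq), Real.log C, 0,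
    fun n _ => ?_⟩
  have hexp : Real.exp (Real.log C - (Real.log q - Real.log lam) * n) =
      C * lam ^ n / q ^ n := by
    have : Real.log C - (Real.log q - Real.log lam) * n =
        Real.log C + n * Real.log lam - n * Real.log q := by ring
    rw [this, Real.exp_sub, Real.exp_add, Real.exp_nat_mul, Real.exp_nat_mul,
      Real.exp_log hC, Real.exp_log hl0, Real.exp_log hq0]
  rw [hexp]
  have hB : q ^ n ≤ (ballCount (Set.univ : Set (FreeGroup (Fin r))) n : ℝ) := by
    rw [hq]
    exact_mod_cast ballCount_univ_ge (r := r) n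
  have hS : (ballCount (Set.univ : Set (FreeGroup (Fin r))) n : ℝ) ≤
      ballCount {w : FreeGroup (Fin r) | Subword v w} n +
        ∑ j ∈ Finset.range (n + 1), ((badWords v.toWord j).card : ℝ) := by
    exact_mod_cast ballCount_split v n
  have hs := hsum n
  have hqn : 0 < q ^ n := by positivity
  have hBpos := hqn.trans_le hB
  have hX : 0 ≤ C * lam ^ n / q ^ n := by positivity
  have hXe : C * lam ^ n / q ^ n * q ^ n = C * lam ^ n := by field_simp
  rw [le_div_iff₀ hBpos]
  have := mul_le_mul_of_nonneg_left hB hX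
  linarith

end VG
end

section
/- Let r ≥ 2, let F be the free group of rank r, let C ⊆ F be the set of cyclically reduced elements, and fix v ∈ F. The set of cyclically reduced elements of F that contain v as a subword is exponentially generic in C. -/
namespace VG

variable {r : ℕ}

/-- Reduced continuations of length `m` of a word ending in `a`. -/
def ext (a : Fin r × Bool) : ℕ → Finset (List (Fin r × Bool))
  | 0 => {[]}
  | m + 1 => (Finset.univ.filter (fun b : Fin r × Bool => b ≠ linv a)).biUnion
      fun b => (ext b m).image (fun t => b :: t)

theorem ok_iff (a b : Fin r × Bool) : (a.1 = b.1 → a.2 = b.2) ↔ b ≠ linv a := by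
  obtain ⟨a1, a2⟩ := a
  obtain ⟨b1, b2⟩ := b
  cases a2 <;> cases b2 <;> simp [linv, Prod.ext_iff, eq_comm]

theorem linv_eq_comm (a b : Fin r × Bool) : b = linv a ↔ a = linv b := by
  obtain ⟨a1, a2⟩ := a
  obtain ⟨b1, b2⟩ := b
  cases a2 <;> cases b2 <;> simp [linv, Prod.ext_iff, eq_comm]

theorem mem_ext (m : ℕ) : ∀ (a : Fin r × Bool) (t : List (Fin r × Bool)),
    t ∈ ext a m ↔ t.length = m ∧ FreeGroup.IsReduced (a :: t) := by
  induction m with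
  | zero =>
    intro a t
    simp only [ext, Finset.mem_singleton, List.length_eq_zero_iff]
    constructor
    · rintro rfl; simp
    · exact fun h => h.1
  | succ m ih =>
    intro a t
    simp only [ext, Finset.mem_biUnion, Finset.mem_filter, Finset.mem_univ, true_and,
      Finset.mem_image, ih]
    constructor
    · rintro ⟨b, hb, s, ⟨hs, hr⟩, rfl⟩
      refine ⟨by simp [hs], ?_⟩
      rw [FreeGroup.isReduced_cons_cons, ok_iff]
      exact ⟨hb, hr⟩
    · rintro ⟨hl, hr⟩
      cases t with
      | nil => simp at hl
      | cons b s =>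
        rw [FreeGroup.isReduced_cons_cons, ok_iff] at hr
        exact ⟨b, hr.1, s, ⟨by simpa using hl, hr.2⟩, rfl⟩

theorem card_ext (m : ℕ) : ∀ (a : Fin r × Bool), (ext a m).card = (2 * r - 1) ^ m := by
  induction m with
  | zero => intro a; simp [ext]
  | succ m ih =>
    intro a
    rw [ext, Finset.card_biUnion]
    · have : ∀ b : Fin r × Bool, ((ext b m).image (fun t => b :: t)).card = (2 * r - 1) ^ m := by
        intro b
        rw [Finset.card_image_of_injective _ (List.cons_injective), ih]
      simp only [this, Finset.sum_const, smul_eq_mul]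
      rw [Finset.filter_ne', Finset.card_erase_of_mem (Finset.mem_univ _)]
      simp [pow_succ, mul_comm]
    · intro b _ c _ hbc
      rw [Function.onFun, Finset.disjoint_left]
      intro t ht ht'
      simp only [Finset.mem_image] at ht ht'
      obtain ⟨s, _, rfl⟩ := ht
      obtain ⟨s', _, h⟩ := ht'
      exact hbc (by simp at h; exact h.1.symm)

theorem exists_letter (hr : 2 ≤ r) (a b : Fin r × Bool) : ∃ c, c ≠ a ∧ c ≠ b := by
  have h : ({a, b} : Finset (Fin r × Bool)).card < Fintype.card (Fin r × Bool) := by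
    have := Finset.card_le_two (a := a) (b := b)
    simp
    omega
  obtain ⟨c, hc⟩ := Finset.exists_mem_notMem_of_card_lt_card (s := {a, b}) (t := Finset.univ)
    (by simpa using h)
  refine ⟨c, ?_⟩
  simpa using hc.2

/-- connecting letter -/
theorem exists_conn (hr : 2 ≤ r) (a : Fin r × Bool) (v : List (Fin r × Bool))
    (hv : FreeGroup.IsReduced v) : ∃ c, FreeGroup.IsReduced (a :: c :: v) := by
  cases v with
  | nil =>
    obtain ⟨c, hc, _⟩ := exists_letter hr (linv a) (linv a)
    exact ⟨c, by rw [FreeGroup.isReduced_cons_cons, ok_iff]; exact ⟨hc, by simp⟩⟩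
  | cons b s =>
    obtain ⟨c, hc, hc'⟩ := exists_letter hr (linv a) (linv b)
    refine ⟨c, ?_⟩
    rw [FreeGroup.isReduced_cons_cons, ok_iff, FreeGroup.isReduced_cons_cons, ok_iff]
    exact ⟨hc, fun h => hc' ((linv_eq_comm _ _).1 h), hv⟩

open Classical in
/-- continuations avoiding `v` -/
noncomputable def avoid (v : List (Fin r × Bool)) (a : Fin r × Bool) (n : ℕ) :
    Finset (List (Fin r × Bool)) := (ext a n).filter (fun t => ¬ v <:+: t)

theorem avoid_step (hr : 2 ≤ r) (v : List (Fin r × Bool)) (hv : FreeGroup.IsReduced v)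
    (n B : ℕ) (h : ∀ a, (avoid v a n).card ≤ B) (a : Fin r × Bool) :
    (avoid v a (n + (v.length + 1))).card ≤ ((2 * r - 1) ^ (v.length + 1) - 1) * B := by
  classical
  obtain ⟨c, hc⟩ := exists_conn hr a v hv
  have hmem : (c :: v) ∈ ext a (v.length + 1) := by
    rw [mem_ext]; exact ⟨by simp, hc⟩
  have hsub : avoid v a (n + (v.length + 1)) ⊆ ((ext a (v.length + 1)).erase (c :: v)).biUnion
      fun t => (avoid v (t.getLastD a) n).image (fun s => t ++ s) := by
    intro w hw
    simp only [avoid, Finset.mem_filter, mem_ext] at hw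
    obtain ⟨⟨hl, hred⟩, hav⟩ := hw
    simp only [Finset.mem_biUnion, Finset.mem_erase, Finset.mem_image, avoid, Finset.mem_filter,
      mem_ext]
    have hw : w.take (v.length + 1) ++ w.drop (v.length + 1) = w := List.take_append_drop _ _
    refine ⟨w.take (v.length + 1), ⟨?_, ?_, ?_⟩, w.drop (v.length + 1), ⟨⟨?_, ?_⟩, ?_⟩, hw⟩
    · intro h
      apply hav
      rw [← hw, h]
      exact ⟨[c], w.drop (v.length + 1), by simp⟩
    · simp [hl]
    · exact hred.infix ⟨[], w.drop (v.length + 1), by simp⟩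
    · simp [hl]
    · have hne : w.take (v.length + 1) ≠ [] := by
        intro h
        have := congrArg List.length h
        simp [hl] at this
      refine hred.infix ⟨a :: (w.take (v.length + 1)).dropLast, [], ?_⟩
      rw [List.getLastD_eq_getLast?, List.getLast?_eq_getLast_of_ne_nil hne]
      conv_rhs => rw [← hw]
      conv_rhs => rw [← List.dropLast_append_getLast hne]
      simp only [Option.getD_some, List.append_assoc, List.append_nil, List.cons_append, List.nil_append]
    · intro h
      exact hav (h.trans (List.drop_suffix _ _).isInfix)
  refine (Finset.card_le_card hsub).trans ?_
  refine (Finset.card_biUnion_le_card_mul _ _ B ?_).trans ?_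
  · intro t _
    exact Finset.card_image_le.trans (h _)
  · rw [Finset.card_erase_of_mem hmem, card_ext]

theorem avoid_bound (hr : 2 ≤ r) (v : List (Fin r × Bool)) (hv : FreeGroup.IsReduced v)
    (s : ℕ) (j : ℕ) : ∀ a, (avoid v a (s + j * (v.length + 1))).card ≤
      ((2 * r - 1) ^ (v.length + 1) - 1) ^ j * (2 * r - 1) ^ s := by
  classical
  induction j with
  | zero =>
    intro a
    simp only [zero_mul, add_zero, pow_zero, one_mul]
    rw [← card_ext s a]
    exact Finset.card_filter_le _ _
  | succ j ih =>
    intro a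
    have := avoid_step hr v hv _ _ ih a
    rw [pow_succ', mul_assoc]
    convert this using 3
    ring

theorem mu_ge (hr : 2 ≤ r) (k : ℕ) : 2 ≤ (2 * r - 1) ^ (k + 1) - 1 := by
  have h : 3 ≤ 2 * r - 1 := by omega
  have : 3 ^ 1 ≤ (2 * r - 1) ^ (k + 1) :=
    (Nat.pow_le_pow_left h 1).trans (Nat.pow_le_pow_right (by omega) (by omega))
  omega

theorem avoid_bound' (hr : 2 ≤ r) (v : List (Fin r × Bool)) (hv : FreeGroup.IsReduced v)
    (i n : ℕ) (hin : i ≤ n) (a) : (avoid v a i).card ≤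
      ((2 * r - 1) ^ (v.length + 1) - 1) ^ (n / (v.length + 1)) * (2 * r - 1) ^ (v.length + 1) := by
  have h := avoid_bound hr v hv (i % (v.length + 1)) (i / (v.length + 1)) a
  rw [Nat.mod_add_div'] at h
  refine h.trans ?_
  have := mu_ge hr v.length
  refine Nat.mul_le_mul (Nat.pow_le_pow_right (by omega) (Nat.div_le_div_right hin))
    (Nat.pow_le_pow_right (by omega) (Nat.mod_lt _ (by omega)).le)

theorem finite_ball (A : Set (FreeGroup (Fin r))) (n : ℕ) : {w | w ∈ A ∧ len w ≤ n}.Finite := by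
  have := List.finite_length_le (Fin r × Bool) n
  refine Set.Finite.subset (this.preimage (f := FreeGroup.toWord)
    FreeGroup.toWord_injective.injOn) ?_
  intro w hw
  exact hw.2

theorem bad_bound (hr : 2 ≤ r) (v : FreeGroup (Fin r)) (n : ℕ) :
    ballCount {w : FreeGroup (Fin r) | CyclicallyReduced w ∧ ¬ Subword v w} n ≤
      (n + 1) * (2 * r * (((2 * r - 1) ^ (len v + 1) - 1) ^ (n / (len v + 1)) *
        (2 * r - 1) ^ (len v + 1))) := by
  classical
  set B := (((2 * r - 1) ^ (len v + 1) - 1) ^ (n / (len v + 1)) *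
        (2 * r - 1) ^ (len v + 1)) with hB
  have hBpos : 1 ≤ B := by
    have := mu_ge hr (len v)
    have h1 : 0 < (2 * r - 1) ^ (len v + 1) := by omega
    exact Nat.mul_pos (Nat.pow_pos (by omega)) h1
  -- the finite set of words
  let T : ℕ → Finset (List (Fin r × Bool)) := fun i =>
    match i with
    | 0 => {[]}
    | i + 1 => Finset.univ.biUnion fun a => (avoid v.toWord a i).image (fun t => a :: t)
  have hT : ∀ i ∈ Finset.range (n + 1), (T i).card ≤ 2 * r * B := by
    intro i hi
    rw [Finset.mem_range] at hi
    cases i with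
    | zero =>
      show Finset.card {[]} ≤ _
      rw [Finset.card_singleton]
      exact Nat.mul_pos (by omega) hBpos
    | succ i =>
      refine (Finset.card_biUnion_le_card_mul _ _ B ?_).trans ?_
      · intro a _
        exact Finset.card_image_le.trans
          (avoid_bound' hr v.toWord FreeGroup.isReduced_toWord i n (by omega) a)
      · simp [mul_comm]
  have hcard : ((Finset.range (n + 1)).biUnion T).card ≤ (n + 1) * (2 * r * B) := by
    refine (Finset.card_biUnion_le_card_mul _ _ _ hT).trans ?_
    simp
  refine le_trans ?_ hcard
  rw [ballCount, ← Set.ncard_coe_finset]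
  refine Set.ncard_le_ncard_of_injOn FreeGroup.toWord ?_ FreeGroup.toWord_injective.injOn
    (Finset.finite_toSet _)
  rintro w ⟨⟨_, hw⟩, hl⟩
  simp only [Finset.coe_biUnion, Set.mem_iUnion, Finset.mem_coe, Finset.mem_range]
  refine ⟨len w, by omega, ?_⟩
  have hred := FreeGroup.isReduced_toWord (x := w)
  unfold Subword at hw
  unfold len
  generalize w.toWord = l at *
  cases l with
  | nil => simp [T]
  | cons a t =>
    simp only [T, List.length_cons, Finset.mem_biUnion, Finset.mem_univ, true_and,
      Finset.mem_image, avoid, Finset.mem_filter, mem_ext]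
    exact ⟨a, t, ⟨⟨rfl, hred⟩, fun h => hw (h.trans (List.suffix_cons _ _).isInfix)⟩, rfl⟩

theorem good_bound (hr : 2 ≤ r) (n : ℕ) :
    (2 * r - 1) ^ n ≤ ballCount {w : FreeGroup (Fin r) | CyclicallyReduced w} (n + 2) := by
  classical
  have a : Fin r × Bool := (⟨0, by omega⟩, true)
  rw [← card_ext n a, ← Set.ncard_coe_finset, ballCount]
  have hc : ∀ t : List (Fin r × Bool), ∃ c, c ≠ linv a ∧ c ≠ linv (t.getLastD a) :=
    fun t => exists_letter hr _ _
  choose c hc1 hc2 using hc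
  have hred : ∀ t ∈ ext a n, (FreeGroup.mk (c t :: a :: t)).toWord = c t :: a :: t := by
    intro t ht
    rw [mem_ext] at ht
    rw [FreeGroup.toWord_mk]
    apply FreeGroup.IsReduced.reduce_eq
    rw [FreeGroup.isReduced_cons_cons, ok_iff]
    exact ⟨fun h => hc1 t ((linv_eq_comm _ _).1 h), ht.2⟩
  refine Set.ncard_le_ncard_of_injOn (fun t => FreeGroup.mk (c t :: a :: t)) ?_ ?_
    (finite_ball _ _)
  · intro t ht
    have h := hred t ht
    have hl := ((mem_ext _ _ _).1 ht).1
    refine ⟨?_, ?_⟩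
    · show CyclicallyReduced _
      unfold CyclicallyReduced
      rw [h]
      intro x hx y hy
      simp only [List.head?_cons, Option.mem_def, Option.some.injEq] at hx
      rw [List.getLast?_cons_cons, List.getLast?_cons, Option.mem_def, Option.some.injEq,
        ← List.getLastD_eq_getLast?] at hy
      subst hx hy
      exact hc2 t
    · show len _ ≤ _
      unfold len
      rw [h]
      simp [hl]
  · intro t ht t' ht' heq
    have := congrArg FreeGroup.toWord heq
    simp only [] at this
    rw [hred t ht, hred t' ht'] at this
    simp at this
    exact this.2

theorem count_split (v : FreeGroup (Fin r)) (n : ℕ) :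
    ballCount {w : FreeGroup (Fin r) | CyclicallyReduced w} n =
    ballCount {w : FreeGroup (Fin r) | CyclicallyReduced w ∧ Subword v w} n +
    ballCount {w : FreeGroup (Fin r) | CyclicallyReduced w ∧ ¬ Subword v w} n := by
  unfold ballCount
  rw [← Set.ncard_union_eq _ (finite_ball _ _) (finite_ball _ _)]
  · congr 1
    ext w
    simp only [Set.mem_setOf_eq, Set.mem_union]
    tauto
  · rw [Set.disjoint_left]
    rintro w ⟨⟨_, h⟩, _⟩ ⟨⟨_, h'⟩, _⟩
    exact h' h

/-- the set of cyclically reduced elements containing `v` as a subword is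
exponentially generic in the set `C` of cyclically reduced elements. -/
theorem subword_expGeneric_cyclicallyReduced {r : ℕ} (hr : 2 ≤ r) (v : FreeGroup (Fin r)) :
    ExpGeneric {w : FreeGroup (Fin r) | CyclicallyReduced w ∧ Subword v w}
      {w : FreeGroup (Fin r) | CyclicallyReduced w} := by
  set m := len v + 1 with hm
  set q := 2 * r - 1 with hq
  set μ := q ^ m - 1 with hμ
  have hμ2 : 2 ≤ μ := mu_ge hr (len v)
  have hq3 : 3 ≤ q := by omega
  have hqpos : (0 : ℝ) < q := by positivity
  have hμpos : (0 : ℝ) < μ := by positivity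
  have hmpos : (0 : ℝ) < m := by positivity
  have hlt : Real.log μ < m * Real.log q := by
    rw [← Real.log_pow]
    apply Real.log_lt_log hμpos
    have : μ < q ^ m := by omega
    exact_mod_cast this
  have hlogμ : 0 ≤ Real.log μ := Real.log_natCast_nonneg _
  set a := (Real.log q - Real.log μ / m) / 2 with ha
  have hapos : 0 < a := by
    have : Real.log μ / m < Real.log q := by rw [div_lt_iff₀ hmpos]; linarith
    rw [ha]; linarith
  set K : ℝ := (1 + 1 / a) * (2 * r * q ^ m) * q ^ 2 with hK
  have hKpos : 0 < K := by
    have : (0 : ℝ) < r := by have : 0 < r := by omega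
                             exact_mod_cast this
    positivity
  refine ⟨a, hapos, Real.log K, 2, ?_⟩
  intro n hn
  have hbad := bad_bound hr v n
  have hgood := good_bound hr (n - 2)
  rw [Nat.sub_add_cancel hn] at hgood
  have hsplit := count_split v n
  set A := ballCount {w : FreeGroup (Fin r) | CyclicallyReduced w ∧ Subword v w} n
  set C := ballCount {w : FreeGroup (Fin r) | CyclicallyReduced w} n
  set D := ballCount {w : FreeGroup (Fin r) | CyclicallyReduced w ∧ ¬ Subword v w} n
  rw [← hq, ← hm, ← hμ] at hbad
  rw [← hq] at hgood
  have hCpos : (0 : ℝ) < C := by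
    have : 0 < q ^ (n - 2) := Nat.pow_pos (by omega)
    have : 0 < C := by omega
    exact_mod_cast this
  have hsplit' : (C : ℝ) = A + D := by exact_mod_cast hsplit
  have hD : (D : ℝ) ≤ (n + 1) * (2 * r * ((μ : ℝ) ^ (n / m) * q ^ m)) := by exact_mod_cast hbad
  have hC : Real.exp (n * Real.log q) ≤ C * q ^ 2 := by
    rw [← Real.log_pow, Real.exp_log (by positivity)]
    have : q ^ n ≤ C * q ^ 2 := by
      calc q ^ n = q ^ (n - 2) * q ^ 2 := by rw [← pow_add, Nat.sub_add_cancel hn]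
        _ ≤ _ := Nat.mul_le_mul_right _ hgood
    exact_mod_cast this
  have hμn : (μ : ℝ) ^ (n / m) ≤ Real.exp (n * (Real.log μ / m)) := by
    rw [← Real.exp_log (pow_pos hμpos (n / m)), Real.log_pow]
    apply Real.exp_le_exp.2
    have : ((n / m : ℕ) : ℝ) ≤ n / m := Nat.cast_div_le
    calc ((n / m : ℕ) : ℝ) * Real.log μ ≤ (n / m) * Real.log μ :=
          mul_le_mul_of_nonneg_right this hlogμ
      _ = _ := by ring
  have hn1 : (n : ℝ) + 1 ≤ (1 + 1 / a) * Real.exp (a * n) := by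
    have h1 := Real.add_one_le_exp (a * n)
    have h2 : (n : ℝ) + 1 ≤ (1 + 1 / a) * (a * n + 1) := by
      have : (1 + 1 / a) * (a * n + 1) = n + 1 + (a * n + 1 / a) := by field_simp; ring
      rw [this]
      have : 0 ≤ a * n + 1 / a := by positivity
      linarith
    exact h2.trans (mul_le_mul_of_nonneg_left h1 (by positivity))
  have hDC : (D : ℝ) ≤ Real.exp (Real.log K - a * n) * C := by
    have h1 : (D : ℝ) ≤ ((1 + 1 / a) * Real.exp (a * n)) *
        (2 * r * (Real.exp (n * (Real.log μ / m)) * q ^ m)) := by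
      refine hD.trans ?_
      gcongr
    have h2 : Real.exp (a * n) * Real.exp (n * (Real.log μ / m)) =
        Real.exp (- (a * n)) * Real.exp (n * Real.log q) := by
      rw [← Real.exp_add, ← Real.exp_add]
      congr 1
      rw [ha]; ring
    calc (D : ℝ) ≤ _ := h1
      _ = ((1 + 1 / a) * (2 * r * q ^ m)) *
          (Real.exp (a * n) * Real.exp (n * (Real.log μ / m))) := by ring
      _ = ((1 + 1 / a) * (2 * r * q ^ m)) * Real.exp (- (a * n)) * Real.exp (n * Real.log q) := by
          rw [h2]; ring
      _ ≤ ((1 + 1 / a) * (2 * r * q ^ m)) * Real.exp (- (a * n)) * (C * q ^ 2) := by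
          gcongr
      _ = _ := by
          rw [sub_eq_add_neg, Real.exp_add, Real.exp_log hKpos, hK]; ring
  rw [le_div_iff₀ hCpos]
  linarith

end VG
end

section
/- Let r ≥ 2 and let F be the free group of rank r. For l ≥ 5 let n(l) be the number of elements w ∈ F with |w| = l for which the cyclic reduction of w has length at most l − 2⌈l/3⌉. Then n(l) / (2r·(2r−1)^{l−1}) ≤ (2r−1)^{−l/3}; equivalently, since the number of elements of F of length exactly l is 2r·(2r−1)^{l−1}, the proportion of elements of length l whose cyclic reduction shortens the word by at least 2⌈l/3⌉ letters is at most (2r−1)^{−l/3}. -/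
namespace VG

variable {r : ℕ}

/-- Reduced continuations of length `n` after the letter `a`. -/
def cont : ℕ → (Fin r × Bool) → Finset (List (Fin r × Bool))
  | 0, _ => {[]}
  | n + 1, a => (Finset.univ.erase (linv a)).biUnion fun b => (cont n b).image (List.cons b)

theorem mem_cont (n : ℕ) : ∀ (a : Fin r × Bool) (L : List (Fin r × Bool)),
    L ∈ cont n a ↔ FreeGroup.IsReduced (a :: L) ∧ L.length = n := by
  induction n with
  | zero =>
    intro a L
    cases L <;> simp [cont]
  | succ n ih =>
    intro a L
    have key : ∀ b : Fin r × Bool, b ≠ linv a ↔ (a.1 = b.1 → a.2 = b.2) := by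
      rintro ⟨b1, b2⟩
      obtain ⟨a1, a2⟩ := a
      cases a2 <;> cases b2 <;> simp [linv, eq_comm]
    cases L with
    | nil => simp [cont]
    | cons c L =>
      simp only [cont, Finset.mem_biUnion, Finset.mem_erase, Finset.mem_univ, and_true,
        Finset.mem_image, List.cons.injEq, FreeGroup.isReduced_cons_cons, ← key, ih,
        List.length_cons, Nat.add_right_cancel_iff]
      constructor
      · rintro ⟨b, hb, L', hL', rfl, rfl⟩
        exact ⟨⟨hb, hL'.1⟩, hL'.2⟩
      · rintro ⟨⟨hb, h1⟩, h2⟩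
        exact ⟨c, hb, L, ⟨h1, h2⟩, rfl, rfl⟩

theorem card_biUnion_cons (s : Finset (Fin r × Bool))
    (f : (Fin r × Bool) → Finset (List (Fin r × Bool))) (m : ℕ) (hf : ∀ b, (f b).card = m) :
    (s.biUnion fun b => (f b).image (List.cons b)).card = s.card * m := by
  rw [Finset.card_biUnion]
  · rw [Finset.sum_congr rfl (g := fun _ => m)]
    · simp
    · intro b _
      rw [Finset.card_image_of_injective _ List.cons_injective, hf]
  · intro a _ b _ hab
    rw [Function.onFun, Finset.disjoint_left]
    intro L h1 h2
    simp only [Finset.mem_image] at h1 h2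
    obtain ⟨_, _, rfl⟩ := h1
    obtain ⟨_, _, h⟩ := h2
    simp only [List.cons.injEq] at h
    exact hab h.1.symm

theorem card_cont (n : ℕ) : ∀ a : Fin r × Bool, (cont n a).card = (2 * r - 1) ^ n := by
  induction n with
  | zero => intro a; simp [cont]
  | succ n ih =>
    intro a
    rw [cont, card_biUnion_cons _ _ _ ih, Finset.card_erase_of_mem (Finset.mem_univ _)]
    simp [pow_succ, mul_comm]

/-- The finset of reduced words of length `n + 1`. -/
def redWords (r n : ℕ) : Finset (List (Fin r × Bool)) :=
  Finset.univ.biUnion fun b => (cont n b).image (List.cons b)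

theorem mem_redWords (n : ℕ) (L : List (Fin r × Bool)) :
    L ∈ redWords r n ↔ FreeGroup.IsReduced L ∧ L.length = n + 1 := by
  cases L with
  | nil => simp [redWords]
  | cons c L =>
    simp [redWords, mem_cont]

theorem card_redWords (n : ℕ) : (redWords r n).card = 2 * r * (2 * r - 1) ^ n := by
  rw [redWords, card_biUnion_cons _ _ _ (card_cont n)]
  simp [mul_comm]

theorem sphere_count (n : ℕ) :
    sphereCount (Set.univ : Set (FreeGroup (Fin r))) (n + 1) = 2 * r * (2 * r - 1) ^ n := by
  rw [← card_redWords, ← Set.ncard_coe_finset, sphereCount,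
    ← Set.ncard_image_of_injective _ FreeGroup.toWord_injective]
  congr 1
  ext L
  simp only [Set.mem_image, Set.mem_ofPred_eq, Set.mem_univ, true_and, Finset.mem_coe,
    mem_redWords, len]
  constructor
  · rintro ⟨w, hw, rfl⟩
    exact ⟨FreeGroup.isReduced_toWord, hw⟩
  · rintro ⟨h1, h2⟩
    have : (FreeGroup.mk L).toWord = L := by rw [FreeGroup.toWord_mk, h1.reduce_eq]
    exact ⟨FreeGroup.mk L, by rw [this, h2], this⟩

theorem norm_pow_le (c : FreeGroup (Fin r)) (n : ℕ) : (c ^ n).norm ≤ n * c.norm := by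
  induction n with
  | zero => simp
  | succ n ih =>
    rw [pow_succ]
    have := FreeGroup.norm_mul_le (c ^ n) c
    linarith

theorem reduceCyclically_length_le (c w g : FreeGroup (Fin r)) (h : w = g * c * g⁻¹) :
    (FreeGroup.reduceCyclically w.toWord).length ≤ len c := by
  by_contra hlt
  push Not at hlt
  have hc : len c = c.norm := rfl
  set n := 2 * g.norm + 1 with hn
  have h1 : (w ^ n).norm = (FreeGroup.reduceCyclically.conjugator w.toWord).length +
      (n * (FreeGroup.reduceCyclically w.toWord).length +
        (FreeGroup.reduceCyclically.conjugator w.toWord).length) := by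
    rw [FreeGroup.norm, FreeGroup.toWord_pow,
      FreeGroup.reduceCyclically.reduce_flatten_replicate_succ FreeGroup.isReduced_toWord]
    simp [hn]
  have h2 : w ^ n = g * c ^ n * g⁻¹ := by rw [h, conj_pow]
  have h3 := FreeGroup.norm_mul_le (g * c ^ n) g⁻¹
  have h4 := FreeGroup.norm_mul_le g (c ^ n)
  have h5 := norm_pow_le c n
  rw [FreeGroup.norm_inv_eq, ← h2] at h3
  rw [hc] at hlt
  have h6 : n * (c.norm + 1) ≤ n * (FreeGroup.reduceCyclically w.toWord).length :=
    Nat.mul_le_mul_left _ hlt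
  rw [mul_add] at h6
  omega

theorem drop_eq_invRev (u m L : List (Fin r × Bool)) (hL : L = u ++ m ++ FreeGroup.invRev u)
    (k : ℕ) (hk : k ≤ u.length) :
    L.drop (L.length - k) = FreeGroup.invRev (L.take k) := by
  have h1 : FreeGroup.invRev L = u ++ FreeGroup.invRev m ++ FreeGroup.invRev u := by
    rw [hL]; simp [FreeGroup.invRev_append]
  have h2 : (FreeGroup.invRev L).take k = L.take k := by
    rw [h1, hL, List.append_assoc, List.append_assoc, List.take_append_of_le_length hk,
      List.take_append_of_le_length hk]
  rw [← h2]
  have h3 : (FreeGroup.invRev L).take k = FreeGroup.invRev (L.drop (L.length - k)) := by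
    simp [FreeGroup.invRev, List.take_reverse]
  rw [h3, FreeGroup.invRev_invRev]

theorem short_count (l k : ℕ) (hk : 2 * k ≤ l) (hkl : k + 1 ≤ l) :
    {w : FreeGroup (Fin r) | len w = l ∧
        ∃ c : FreeGroup (Fin r), IsCyclicReduction c w ∧ len c ≤ l - 2 * k}.ncard ≤
      2 * r * (2 * r - 1) ^ (l - k - 1) := by
  rw [← card_redWords, ← Set.ncard_coe_finset]
  have key : ∀ w : FreeGroup (Fin r), (len w = l ∧
        ∃ c : FreeGroup (Fin r), IsCyclicReduction c w ∧ len c ≤ l - 2 * k) →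
      w.toWord.drop (l - k) = FreeGroup.invRev (w.toWord.take k) := by
    rintro w ⟨hw, c, ⟨_, g, hg⟩, hc⟩
    have h1 := reduceCyclically_length_le c w g hg
    have h2 := FreeGroup.reduceCyclically.conj_conjugator_reduceCyclically w.toWord
    have h3 := congrArg List.length h2
    simp only [List.length_append, FreeGroup.invRev_length] at h3
    unfold len at hw
    rw [← drop_eq_invRev _ _ _ h2.symm k (by omega), hw]
  refine Set.ncard_le_ncard_of_injOn (fun w => w.toWord.take (l - k)) ?_ ?_ (Finset.finite_toSet _)
  · rintro w ⟨hw, -⟩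
    unfold len at hw
    simp only [Finset.mem_coe, mem_redWords]
    refine ⟨FreeGroup.isReduced_toWord.infix (List.take_prefix _ _).isInfix, ?_⟩
    rw [List.length_take]
    omega
  · intro w hw w' hw' heq
    simp only at heq
    have e1 := key w hw
    have e2 := key w' hw'
    have e3 : w.toWord.take k = w'.toWord.take k := by
      have := congrArg (List.take k) heq
      rwa [List.take_take, List.take_take, min_eq_left (by omega)] at this
    apply FreeGroup.toWord_injective
    rw [← List.take_append_drop (l - k) w.toWord, heq, e1, e3, ← e2, List.take_append_drop]

/-- the sphere of radius `l` has `2r(2r-1)^(l-1)` elements, and the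
proportion of elements of length `l` whose cyclic reduction has length at most
`l - 2⌈l/3⌉` is at most `(2r-1)^(-l/3)`. -/
theorem short_cyclic_reduction_proportion {r : ℕ} (hr : 2 ≤ r) (l : ℕ) (hl : 5 ≤ l) :
    sphereCount (Set.univ : Set (FreeGroup (Fin r))) l = 2 * r * (2 * r - 1) ^ (l - 1) ∧
    (({w : FreeGroup (Fin r) | len w = l ∧
        ∃ c : FreeGroup (Fin r), IsCyclicReduction c w ∧
          len c ≤ l - 2 * ((l + 2) / 3)}.ncard : ℝ)) /
        (2 * (r : ℝ) * (2 * (r : ℝ) - 1) ^ (l - 1)) ≤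
      (2 * (r : ℝ) - 1) ^ (-(l : ℝ) / 3) := by
  obtain ⟨n, rfl⟩ : ∃ n, l = n + 1 := ⟨l - 1, by omega⟩
  refine ⟨sphere_count n, ?_⟩
  set k := (n + 1 + 2) / 3 with hk
  have h := short_count (r := r) (n + 1) k (by omega) (by omega)
  have hr' : (2 : ℝ) ≤ r := by exact_mod_cast hr
  have hq : (1 : ℝ) ≤ 2 * (r : ℝ) - 1 := by linarith
  have hq0 : (0 : ℝ) < 2 * (r : ℝ) - 1 := by linarith
  have hcast : ((2 * r - 1 : ℕ) : ℝ) = 2 * (r : ℝ) - 1 := by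
    rw [Nat.cast_sub (by omega)]; push_cast; ring
  have h' : (({w : FreeGroup (Fin r) | len w = n + 1 ∧
        ∃ c : FreeGroup (Fin r), IsCyclicReduction c w ∧
          len c ≤ n + 1 - 2 * k}.ncard : ℝ)) ≤
      2 * (r : ℝ) * (2 * (r : ℝ) - 1) ^ (n - k) := by
    have e : n + 1 - k - 1 = n - k := by omega
    rw [e] at h
    rw [← hcast]
    exact_mod_cast h
  rw [div_le_iff₀ (by positivity)]
  refine h'.trans ?_
  have e1 : ((2 * (r : ℝ) - 1) ^ (n - k) : ℝ) =
      (2 * (r : ℝ) - 1) ^ (-(k : ℝ)) * (2 * (r : ℝ) - 1) ^ n := by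
    rw [← Real.rpow_natCast, ← Real.rpow_natCast, ← Real.rpow_add hq0,
      Nat.cast_sub (by omega)]
    congr 1; ring
  have e2 : (2 * (r : ℝ) - 1) ^ (-(k : ℝ)) ≤
      (2 * (r : ℝ) - 1) ^ (-((n + 1 : ℕ) : ℝ) / 3) := by
    apply Real.rpow_le_rpow_of_exponent_le hq
    have : ((n + 1 : ℕ) : ℝ) ≤ 3 * (k : ℝ) := by
      exact_mod_cast (by omega : n + 1 ≤ 3 * k)
    linarith
  rw [e1, Nat.add_sub_cancel]
  calc _ = (2 * (r : ℝ) - 1) ^ (-(k : ℝ)) * (2 * (r : ℝ) * (2 * (r : ℝ) - 1) ^ n) := by ring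
    _ ≤ _ := mul_le_mul_of_nonneg_right e2 (by positivity)

end VG
end
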